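/- Consider an n-party (n,2,2) TC problem (|O_i| = |D_i| = 2 for every party i) with weighted utility array w. Then the quantum value q*(w) equals the supremum of expected utilities over qubit quantum strategies (q_i = 2 for all i) in which, for every party, the measurement for the first observation is in the computational basis {|0⟩⟨0|, |1⟩⟨1|} and the measurement for the second observation consists of projectors with real entries (the rank-one projectors onto (cos θ_i, −sin θ_i) and (sin θ_i, cos θ_i) for some real θ_i). Equivalently, n real parameters θ_1,…,θ_n suffice to parameterize an optimal family of measurement settings; in particular, the measurement phases λ_{2,1}^{(j)} in the general single-qubit basis parameterization (cos θ, −e^{iλ} sin θ) can be set to zero without changing the supremum, since conjugating each party's projectors by the diagonal unitary Z_{−λ} = diag(1, e^{−iλ}) removes the phase without changing the largest eigenvalue of the Bell operator. The same holds for the {η_i}-lossy value for any efficiencies η_i ∈ [0,1]. -/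

import Mathlib

open scoped BigOperators

namespace TC

/-- A behavior: a conditional probability distribution over joint decisions given
joint observations. -/
def IsBehavior {n : ℕ} {O D : Fin n → Type} [∀ i, Fintype (D i)]
    (p : (∀ i, O i) → (∀ i, D i) → ℝ) : Prop :=
  (∀ o d, 0 ≤ p o d) ∧ ∀ o, ∑ d, p o d = 1

/-- The behavior of a deterministic strategy `f`. -/
def detBehavior {n : ℕ} {O D : Fin n → Type} [∀ i, DecidableEq (D i)]
    (f : ∀ i, O i → D i) : (∀ i, O i) → (∀ i, D i) → ℝ :=
  fun o d => ∏ i, if d i = f i (o i) then (1 : ℝ) else 0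

/-- Expected utility of a behavior `p` with respect to a weighted utility array `w`. -/
def expUtility {n : ℕ} {O D : Fin n → Type} [∀ i, Fintype (O i)] [∀ i, Fintype (D i)]
    (w p : (∀ i, O i) → (∀ i, D i) → ℝ) : ℝ :=
  ∑ o, ∑ d, p o d * w o d

/-- A quantum strategy: a finite dimension for each party, a projective measurement
(indexed by decisions) for each party and observation, and a shared unit state vector. -/
structure QStrategy {n : ℕ} (O D : Fin n → Type) [∀ i, Fintype (O i)] [∀ i, Fintype (D i)] where
  dim : Fin n → ℕ
  dim_pos : ∀ i, 0 < dim i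
  proj : ∀ i, O i → D i → Matrix (Fin (dim i)) (Fin (dim i)) ℂ
  proj_herm : ∀ i o d, (proj i o d).IsHermitian
  proj_idem : ∀ i o d, proj i o d * proj i o d = proj i o d
  proj_orth : ∀ i o d d', d ≠ d' → proj i o d * proj i o d' = 0
  proj_sum : ∀ i o, ∑ d, proj i o d = 1
  state : (∀ i, Fin (dim i)) → ℂ
  state_norm : ∑ x, Complex.normSq (state x) = 1

/-- The behavior determined by a family of "projectors" (measurement operators, one for each
party, observation and decision) and a shared state:
`p(d|o) = ⟨ψ, (⊗ᵢ Πᵢ^{(dᵢ|oᵢ)}) ψ⟩`. -/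
noncomputable def projBehavior {n : ℕ} {O D : Fin n → Type} (dim : Fin n → ℕ)
    (proj : ∀ i, O i → D i → Matrix (Fin (dim i)) (Fin (dim i)) ℂ)
    (ψ : (∀ i, Fin (dim i)) → ℂ) : (∀ i, O i) → (∀ i, D i) → ℝ :=
  fun o d =>
    (∑ x, ∑ y, (starRingEnd ℂ) (ψ x) * (∏ i, proj i (o i) (d i) (x i) (y i)) * ψ y).re

/-- The quantum behavior of a quantum strategy. -/
noncomputable def QStrategy.behavior {n : ℕ} {O D : Fin n → Type}
    [∀ i, Fintype (O i)] [∀ i, Fintype (D i)] (S : QStrategy O D) :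
    (∀ i, O i) → (∀ i, D i) → ℝ :=
  projBehavior S.dim S.proj S.state

/-- The classical value: the maximum expected utility over deterministic strategies. -/
noncomputable def cValue {n : ℕ} {O D : Fin n → Type} [∀ i, Fintype (O i)] [∀ i, Fintype (D i)]
    [∀ i, DecidableEq (D i)] (w : (∀ i, O i) → (∀ i, D i) → ℝ) : ℝ :=
  ⨆ f : ∀ i, O i → D i, expUtility w (detBehavior f)

/-- The quantum value: the supremum of expected utilities over all quantum strategies
(of all finite dimensions). -/
noncomputable def qValue {n : ℕ} {O D : Fin n → Type} [∀ i, Fintype (O i)] [∀ i, Fintype (D i)]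
    (w : (∀ i, O i) → (∀ i, D i) → ℝ) : ℝ :=
  sSup {x : ℝ | ∃ S : QStrategy O D, x = expUtility w S.behavior}

/-- The gap `g(w) = q*(w) − c*(w)`. -/
noncomputable def gap {n : ℕ} {O D : Fin n → Type} [∀ i, Fintype (O i)] [∀ i, Fintype (D i)]
    [∀ i, DecidableEq (D i)] (w : (∀ i, O i) → (∀ i, D i) → ℝ) : ℝ :=
  qValue w - cValue w

/-- `w` is gapped if its gap is positive. -/
def Gapped {n : ℕ} {O D : Fin n → Type} [∀ i, Fintype (O i)] [∀ i, Fintype (D i)]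
    [∀ i, DecidableEq (D i)] (w : (∀ i, O i) → (∀ i, D i) → ℝ) : Prop :=
  0 < gap w

/-- A quantum strategy is degenerate if some party uses a trivial (zero or identity)
measurement operator. -/
def QStrategy.Degenerate {n : ℕ} {O D : Fin n → Type}
    [∀ i, Fintype (O i)] [∀ i, Fintype (D i)] (S : QStrategy O D) : Prop :=
  ∃ i o d, S.proj i o d = 0 ∨ S.proj i o d = 1

/-- A classical behavior: a convex combination of deterministic behaviors. -/
def IsClassicalBehavior {n : ℕ} {O D : Fin n → Type}
    [∀ i, Fintype (O i)] [∀ i, DecidableEq (O i)] [∀ i, Fintype (D i)] [∀ i, DecidableEq (D i)]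
    (p : (∀ i, O i) → (∀ i, D i) → ℝ) : Prop :=
  ∃ μ : (∀ i, O i → D i) → ℝ, (∀ f, 0 ≤ μ f) ∧ ∑ f, μ f = 1 ∧
    ∀ o d, p o d = ∑ f, μ f * detBehavior f o d

/-- The lossy behavior built from a family of measurement operators, a shared state, a fallback
deterministic strategy `f`, and efficiencies `η`: the sum over subsets `T` of parties that
experience loss, weighted by the loss probabilities, of the behavior of the `T`-semiclassical
strategy (parties in `T` use the trivial projectors implementing `f` locally). -/
noncomputable def lossyProjBehavior {n : ℕ} {O D : Fin n → Type} [∀ i, DecidableEq (D i)]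
    (dim : Fin n → ℕ) (proj : ∀ i, O i → D i → Matrix (Fin (dim i)) (Fin (dim i)) ℂ)
    (ψ : (∀ i, Fin (dim i)) → ℂ) (f : ∀ i, O i → D i) (η : Fin n → ℝ) :
    (∀ i, O i) → (∀ i, D i) → ℝ :=
  fun o d => ∑ T : Finset (Fin n),
    ((∏ i ∈ T, (1 - η i)) * ∏ i ∈ Tᶜ, η i) *
      projBehavior dim
        (fun i oi di =>
          if i ∈ T then (if di = f i oi then (1 : Matrix (Fin (dim i)) (Fin (dim i)) ℂ) else 0)
          else proj i oi di)
        ψ o d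

/-- The `{ηᵢ}`-lossy behavior of a pair `(S_q, S_d)` of a quantum strategy and a fallback
deterministic strategy. -/
noncomputable def lossyBehavior {n : ℕ} {O D : Fin n → Type}
    [∀ i, Fintype (O i)] [∀ i, Fintype (D i)] [∀ i, DecidableEq (D i)]
    (S : QStrategy O D) (f : ∀ i, O i → D i) (η : Fin n → ℝ) :
    (∀ i, O i) → (∀ i, D i) → ℝ :=
  lossyProjBehavior S.dim S.proj S.state f η

/-- The `ν`-noisy behavior of a quantum strategy:
`p_o^d(ν) = tr[(⊗ᵢ Πᵢ^{(dᵢ|oᵢ)}) ((1−ν)|ψ⟩⟨ψ| + ν π)]` with `π` the maximally mixed state. -/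
noncomputable def noisyBehavior {n : ℕ} {O D : Fin n → Type}
    [∀ i, Fintype (O i)] [∀ i, Fintype (D i)] (S : QStrategy O D) (ν : ℝ) :
    (∀ i, O i) → (∀ i, D i) → ℝ :=
  fun o d =>
    (∑ x, ∑ y, (∏ i, S.proj i (o i) (d i) (x i) (y i)) *
      ((1 - ν) * (S.state y * (starRingEnd ℂ) (S.state x)) +
        ((ν : ℂ) / (∏ i, (S.dim i : ℂ))) * (if x = y then 1 else 0))).re

end TC

namespace TC

/-- The real rank-one qubit projectors with angle `α`: for decision `false` the projector onto
`(cos α, −sin α)`, for decision `true` the projector onto `(sin α, cos α)`. At `α = 0` this is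
the computational-basis measurement `{|0⟩⟨0|, |1⟩⟨1|}`. -/
noncomputable def qubitProj (α : ℝ) : Bool → Matrix (Fin 2) (Fin 2) ℂ :=
  fun b =>
    Matrix.of fun i j =>
      ((((if b then ![Real.sin α, Real.cos α] else ![Real.cos α, -Real.sin α]) i) *
        ((if b then ![Real.sin α, Real.cos α] else ![Real.cos α, -Real.sin α]) j) : ℝ) : ℂ)

end TC

namespace TC

open Matrix
open scoped ComplexOrder

lemma qubitProj_isHermitian (α : ℝ) (b : Bool) : (qubitProj α b).IsHermitian := by
  ext i j
  fin_cases i <;> fin_cases j <;> cases b <;>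
    simp [qubitProj, mul_comm, -Complex.ofReal_sin, -Complex.ofReal_cos]

lemma qubitProj_mul_self (α : ℝ) (b : Bool) : qubitProj α b * qubitProj α b = qubitProj α b := by
  have h : (Real.sin α : ℂ) ^ 2 + (Real.cos α : ℂ) ^ 2 = 1 := by
    exact_mod_cast Real.sin_sq_add_cos_sq α
  ext i j
  fin_cases i <;> fin_cases j <;> cases b <;>
    simp [qubitProj, Matrix.mul_apply, -Complex.ofReal_sin, -Complex.ofReal_cos] <;> grind

lemma qubitProj_mul_of_ne (α : ℝ) {b b' : Bool} (hb : b ≠ b') :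
    qubitProj α b * qubitProj α b' = 0 := by
  ext i j
  fin_cases i <;> fin_cases j <;> cases b <;> cases b' <;>
    simp [qubitProj, Matrix.mul_apply] at hb ⊢ <;> ring

lemma sum_qubitProj (α : ℝ) : ∑ b, qubitProj α b = 1 := by
  have h : (Real.sin α : ℂ) ^ 2 + (Real.cos α : ℂ) ^ 2 = 1 := by
    exact_mod_cast Real.sin_sq_add_cos_sq α
  ext i j
  fin_cases i <;> fin_cases j <;>
    simp [qubitProj, -Complex.ofReal_sin, -Complex.ofReal_cos] <;> grind

lemma qubitProj_true (α : ℝ) : qubitProj α true = 1 - qubitProj α false := by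
  rw [← sum_qubitProj α, Fintype.sum_bool, add_sub_cancel_right]

/-- The triple `(P, Q, E)` is a finite sum of compressions of qubit triples consisting of the
computational-basis projector, a real rank-one projector and the identity. -/
def BlockDecomposable {m : Type*} [Fintype m] (P Q E : Matrix m m ℂ) : Prop :=
  ∃ (K : Type) (_ : Fintype K) (θ : K → ℝ) (V : K → Matrix (Fin 2) m ℂ),
    P = ∑ k, (V k)ᴴ * qubitProj 0 false * V k ∧
    Q = ∑ k, (V k)ᴴ * qubitProj (θ k) false * V k ∧
    E = ∑ k, (V k)ᴴ * V k

namespace BlockDecomposable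

lemma sum {m : Type*} [Fintype m] {ι : Type} [Fintype ι] {P Q E : ι → Matrix m m ℂ}
    (h : ∀ i, BlockDecomposable (P i) (Q i) (E i)) :
    BlockDecomposable (∑ i, P i) (∑ i, Q i) (∑ i, E i) := by
  choose K hK θ V hP hQ hE using h
  refine ⟨Σ i, K i, inferInstance, fun k => θ k.1 k.2, fun k => V k.1 k.2, ?_, ?_, ?_⟩
  · rw [Fintype.sum_sigma]; exact Finset.sum_congr rfl fun i _ => hP i
  · rw [Fintype.sum_sigma]; exact Finset.sum_congr rfl fun i _ => hQ i
  · rw [Fintype.sum_sigma]; exact Finset.sum_congr rfl fun i _ => hE i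

lemma conj {m : Type*} [Fintype m] {P Q E : Matrix m m ℂ}
    (h : BlockDecomposable P Q E) (U : Matrix m m ℂ) :
    BlockDecomposable (U * P * Uᴴ) (U * Q * Uᴴ) (U * E * Uᴴ) := by
  obtain ⟨K, hK, θ, V, rfl, rfl, rfl⟩ := h
  refine ⟨K, hK, θ, fun k => V k * Uᴴ, ?_, ?_, ?_⟩ <;>
    simp [Matrix.mul_sum, Matrix.sum_mul, Matrix.mul_assoc]

lemma of_factor {m : ℕ} {P Q E : Matrix (Fin m) (Fin m) ℂ} (A B : Matrix (Fin m) (Fin m) ℂ)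
    (θ : ℝ) (hP : P = Aᴴ * A)
    (hQ : Q = ((Real.cos θ : ℂ) • A - (Real.sin θ : ℂ) • B)ᴴ *
      ((Real.cos θ : ℂ) • A - (Real.sin θ : ℂ) • B))
    (hE : E = Aᴴ * A + Bᴴ * B) : BlockDecomposable P Q E := by
  refine ⟨Fin m, inferInstance, fun _ => θ, fun j => Matrix.of ![A j, B j], ?_, ?_, ?_⟩
  · subst hP
    ext x y
    simp [Matrix.sum_apply, Matrix.mul_apply, qubitProj]
  · subst hQ
    ext x y
    simp only [Matrix.sum_apply, Matrix.mul_apply]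
    refine Finset.sum_congr rfl fun j _ => ?_
    simp [Fin.sum_univ_two, qubitProj, -Complex.ofReal_sin, -Complex.ofReal_cos]
    ring
  · subst hE
    ext x y
    simp [Matrix.sum_apply, Matrix.mul_apply, Finset.sum_add_distrib]

/-- Jordan's lemma on a single eigenspace of `(P + Q - 1)²`. -/
lemma of_eigenspace {m : ℕ} {p q e : Matrix (Fin m) (Fin m) ℂ} {l : ℝ}
    (hl0 : 0 ≤ l) (hl1 : l ≤ 1) (hp : pᴴ = p) (hq : qᴴ = q) (he : eᴴ = e)
    (hpp : p * p = p) (hqq : q * q = q) (hee : e * e = e)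
    (hpe : p * e = p) (hep : e * p = p) (hqe : q * e = q)
    (h : p * q + q * p = ((l : ℂ) - 1) • e + p + q) : BlockDecomposable p q e := by
  have hpqp : p * q * p = (l : ℂ) • p := by
    have := congrArg (p * ·) h
    simp only [mul_add, ← mul_assoc, hpp, mul_smul_comm, hpe] at this
    linear_combination (norm := module) this
  have hqpq : q * p * q = (l : ℂ) • q := by
    have := congrArg (q * ·) h
    simp only [mul_add, ← mul_assoc, hqq, mul_smul_comm, hqe] at this
    linear_combination (norm := module) this
  rcases hl0.eq_or_lt with rfl | hl0'
  · have h0 : q * p = 0 := by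
      rw [← Matrix.conjTranspose_mul_self_eq_zero, conjTranspose_mul, hp, hq,
        mul_assoc, ← mul_assoc q, hqq, ← mul_assoc, hpqp]
      simp
    have h0' : p * q = 0 := by
      simpa [hp, hq] using congrArg conjTranspose h0
    have hqe' : q = e - p := by
      rw [h0, h0'] at h
      simp only [Complex.ofReal_zero, zero_sub, neg_smul, one_smul, add_zero] at h
      linear_combination (norm := module) -h
    refine of_factor p (e - p) (Real.pi / 2) ?_ ?_ ?_
    · rw [hp, hpp]
    · simp [hqe', he, hp, sub_mul, mul_sub, hpp, hee, hpe, hep]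
    · simp [he, hp, sub_mul, mul_sub, hpp, hee, hpe, hep]
  rcases hl1.eq_or_lt with rfl | hl1'
  · have hpq : p = q := by
      rw [← sub_eq_zero, ← Matrix.conjTranspose_mul_self_eq_zero, conjTranspose_sub, hp, hq,
        sub_mul, mul_sub, mul_sub, hpp, hqq]
      simp only [Complex.ofReal_one, sub_self, zero_smul, zero_add] at h
      linear_combination (norm := module) -h
    refine of_factor p (e - p) 0 ?_ ?_ ?_
    · rw [hp, hpp]
    · simp [← hpq, hp, hpp]
    · simp [he, hp, sub_mul, mul_sub, hpp, hee, hpe, hep]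
  have hcos : Real.cos (Real.arccos (√l)) = √l :=
    Real.cos_arccos (by linarith [Real.sqrt_nonneg l]) (Real.sqrt_le_one.mpr hl1)
  have hsin : Real.sin (Real.arccos (√l)) = √(1 - l) := by
    rw [Real.sin_arccos, Real.sq_sqrt hl0]
  obtain ⟨c, hc⟩ : ∃ c : ℝ, √l = c := ⟨_, rfl⟩
  obtain ⟨s, hs⟩ : ∃ s : ℝ, √(1 - l) = s := ⟨_, rfl⟩
  have hc0 : (c : ℂ) ≠ 0 := by
    rw [← hc]; exact_mod_cast (Real.sqrt_pos.2 hl0').ne'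
  have hs0 : (s : ℂ) ≠ 0 := by
    rw [← hs]; exact_mod_cast (Real.sqrt_pos.2 (sub_pos.2 hl1')).ne'
  have hcl : (l : ℂ) = c ^ 2 := by
    rw [← hc]; exact_mod_cast (Real.sq_sqrt hl0).symm
  have hsl : 1 - (l : ℂ) = s ^ 2 := by
    rw [← hs]; exact_mod_cast (Real.sq_sqrt (sub_nonneg.2 hl1)).symm
  have hB : (p * q - (l : ℂ) • p)ᴴ = q * p - (l : ℂ) • p := by
    simp [hp, hq]
  have hBB : (q * p - (l : ℂ) • p) * (p * q - (l : ℂ) • p) =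
      ((l : ℂ) * (1 - l)) • (e - p) := by
    have h1 : (q * p - (l : ℂ) • p) * (p * q - (l : ℂ) • p) =
        (l : ℂ) • (q - (p * q + q * p) + (l : ℂ) • p) := by
      have h2 : p * (p * q) = p * q := by rw [← mul_assoc, hpp]
      have h3 : q * (p * q) = (l : ℂ) • q := by rw [← mul_assoc, hqpq]
      simp only [sub_mul, mul_sub, mul_smul_comm, smul_mul_assoc, mul_assoc, hpp, h2, h3]
      module
    rw [h1, h]
    module
  refine of_factor p ((-((c : ℂ) * s)⁻¹) • (p * q - (l : ℂ) • p)) (Real.arccos (√l)) ?_ ?_ ?_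
  · rw [hp, hpp]
  · have : ((Real.cos (Real.arccos (√l)) : ℂ) • p - (Real.sin (Real.arccos (√l)) : ℂ) •
        ((-((c : ℂ) * s)⁻¹) • (p * q - (l : ℂ) • p))) = (c : ℂ)⁻¹ • (p * q) := by
      rw [hcos, hsin, hc, hs, hcl, smul_smul]
      have h1 : (s : ℂ) * -((c : ℂ) * s)⁻¹ = -(c : ℂ)⁻¹ := by field_simp
      rw [h1, neg_smul, sub_neg_eq_add, smul_sub, smul_smul]
      have h2 : (c : ℂ)⁻¹ * c ^ 2 = c := by field_simp
      rw [h2]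
      abel
    rw [this, conjTranspose_smul, conjTranspose_mul, hp, hq, smul_mul_smul_comm, mul_assoc q,
      ← mul_assoc p, hpp, ← mul_assoc, hqpq, smul_smul]
    have h1 : star (c : ℂ)⁻¹ * (c : ℂ)⁻¹ * l = 1 := by
      rw [hcl]; simp; field_simp
    rw [h1, one_smul]
  · rw [hp, hpp, conjTranspose_smul, hB, smul_mul_smul_comm, hBB, smul_smul]
    have h1 : star (-((c : ℂ) * s)⁻¹) * -((c : ℂ) * s)⁻¹ * (l * (1 - l)) = 1 := by
      rw [hsl, hcl]; simp; field_simp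
    rw [h1, one_smul]
    abel

/-- Jordan's lemma for two projections for which `(P + Q - 1)²` is diagonal. -/
lemma of_diagonal {m : ℕ} {P Q : Matrix (Fin m) (Fin m) ℂ} (hP : Pᴴ = P) (hQ : Qᴴ = Q)
    (hPP : P * P = P) (hQQ : Q * Q = Q) (l : Fin m → ℝ)
    (hl : (P + Q - 1) * (P + Q - 1) = diagonal fun j => (l j : ℂ)) :
    BlockDecomposable P Q 1 := by
  have hl' : (P - Q) * (P - Q) = 1 - diagonal fun j => (l j : ℂ) := by
    rw [← hl]; simp only [mul_sub, sub_mul, mul_add, add_mul, hPP, hQQ, mul_one, one_mul]; abel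
  have hl0 (j) : 0 ≤ l j := by
    have h1 : (P + Q - 1)ᴴ * (P + Q - 1) = diagonal fun j => (l j : ℂ) := by
      rw [← hl]; simp [hP, hQ]
    have h2 := (posSemidef_conjTranspose_mul_self (P + Q - 1)).diag_nonneg (i := j)
    rw [h1] at h2
    simpa using h2
  have hl1 (j) : l j ≤ 1 := by
    have h1 : (P - Q)ᴴ * (P - Q) = 1 - diagonal fun j => (l j : ℂ) := by
      rw [← hl']; simp [hP, hQ]
    have h2 := (posSemidef_conjTranspose_mul_self (P - Q)).diag_nonneg (i := j)
    rw [h1] at h2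
    simp only [Matrix.sub_apply, one_apply_eq, diagonal_apply_eq, sub_nonneg] at h2
    exact_mod_cast h2
  let E : ℝ → Matrix (Fin m) (Fin m) ℂ := fun μ => diagonal fun j => if l j = μ then 1 else 0
  have hcomm {X : Matrix (Fin m) (Fin m) ℂ}
      (hX : X * diagonal (fun j => (l j : ℂ)) = diagonal (fun j => (l j : ℂ)) * X) (μ : ℝ) :
      X * E μ = E μ * X := by
    ext i j
    have h1 := congrFun (congrFun hX i) j
    simp only [mul_diagonal, diagonal_mul, E] at h1 ⊢
    by_cases h0 : X i j = 0
    · simp [h0]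
    have h2 : l i = l j := by
      have : (l i : ℂ) = l j := mul_right_cancel₀ h0 (by rw [← h1, mul_comm])
      exact_mod_cast this
    simp [h2]
  have hPE := hcomm (X := P) (by
    rw [← hl]; simp only [mul_sub, sub_mul, mul_add, add_mul, ← mul_assoc, hPP, mul_one, one_mul]
    simp only [mul_assoc, hPP, hQQ]
    abel)
  have hQE := hcomm (X := Q) (by
    rw [← hl]; simp only [mul_sub, sub_mul, mul_add, add_mul, ← mul_assoc, hQQ, mul_one, one_mul]
    simp only [mul_assoc, hPP, hQQ]
    abel)
  have hEE (μ) : E μ * E μ = E μ := by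
    simp [E, diagonal_mul_diagonal]
  have hEH (μ) : (E μ)ᴴ = E μ := by
    simp only [E, diagonal_conjTranspose]
    congr 1; ext j; simp [apply_ite]
  have hsum : ∑ μ : ↥(Finset.univ.image l), E μ = 1 := by
    rw [Finset.sum_coe_sort (Finset.univ.image l) E]
    ext i j
    rw [Matrix.sum_apply]
    by_cases hij : i = j
    · subst hij
      simp [E]
    · simp [E, hij]
  have key (μ : ↥(Finset.univ.image l)) : BlockDecomposable (P * E μ) (Q * E μ) (E μ) := by
    obtain ⟨μ, hμ⟩ := μ
    obtain ⟨j, -, rfl⟩ := Finset.mem_image.1 hμ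
    have hmul (X Y : Matrix (Fin m) (Fin m) ℂ) (hY : Y * E (l j) = E (l j) * Y) :
        X * E (l j) * (Y * E (l j)) = X * Y * E (l j) := by
      rw [mul_assoc, ← mul_assoc (E _), ← hY, mul_assoc Y, hEE, mul_assoc]
    have hD : (diagonal fun j => (l j : ℂ)) * E (l j) = (l j : ℂ) • E (l j) := by
      ext x y
      by_cases hxy : x = y
      · subst hxy
        by_cases hx : l x = l j <;> simp [E, hx]
      · simp [E, hxy]
    refine of_eigenspace (hl0 j) (hl1 j) ?_ ?_ (hEH _) ?_ ?_ (hEE _) ?_ ?_ ?_ ?_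
    · rw [conjTranspose_mul, hEH, hP, hPE]
    · rw [conjTranspose_mul, hEH, hQ, hQE]
    · rw [hmul _ _ (hPE _), hPP]
    · rw [hmul _ _ (hQE _), hQQ]
    · rw [mul_assoc, hEE]
    · rw [← mul_assoc, ← hPE, mul_assoc, hEE]
    · rw [mul_assoc, hEE]
    · rw [hmul _ _ (hQE _), hmul _ _ (hPE _), sub_smul, ← hD, ← hl, one_smul]
      simp only [mul_sub, sub_mul, mul_add, add_mul, hPP, hQQ, mul_one, one_mul]
      abel
  have := BlockDecomposable.sum key
  rwa [← Matrix.mul_sum, ← Matrix.mul_sum, hsum, mul_one, mul_one] at this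

/-- Jordan's lemma for two projections. -/
lemma of_projections {m : ℕ} {P Q : Matrix (Fin m) (Fin m) ℂ} (hP : Pᴴ = P) (hQ : Qᴴ = Q)
    (hPP : P * P = P) (hQQ : Q * Q = Q) : BlockDecomposable P Q 1 := by
  have hH : ((P + Q - 1) * (P + Q - 1)).IsHermitian := by
    simp [Matrix.IsHermitian, hP, hQ]
  have hspec := hH.conjStarAlgAut_star_eigenvectorUnitary
  set U : Matrix (Fin m) (Fin m) ℂ := (hH.eigenvectorUnitary : Matrix (Fin m) (Fin m) ℂ) with hU
  have hUU : Uᴴ * U = 1 := by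
    simpa [star_eq_conjTranspose] using Unitary.coe_star_mul_self hH.eigenvectorUnitary
  have hUU' : U * Uᴴ = 1 := by
    simpa [star_eq_conjTranspose] using Unitary.coe_mul_star_self hH.eigenvectorUnitary
  have hmul (X Y : Matrix (Fin m) (Fin m) ℂ) : Uᴴ * X * U * (Uᴴ * Y * U) = Uᴴ * (X * Y) * U := by
    calc _ = Uᴴ * X * (U * Uᴴ) * Y * U := by simp only [mul_assoc]
      _ = _ := by rw [hUU', mul_one]; simp only [mul_assoc]
  have hback (X : Matrix (Fin m) (Fin m) ℂ) : U * (Uᴴ * X * U) * Uᴴ = X := by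
    calc _ = (U * Uᴴ) * X * (U * Uᴴ) := by simp only [mul_assoc]
      _ = _ := by rw [hUU', mul_one, one_mul]
  have := of_diagonal (P := Uᴴ * P * U) (Q := Uᴴ * Q * U) (by simp [hP, mul_assoc])
    (by simp [hQ, mul_assoc]) (by rw [hmul, hPP]) (by rw [hmul, hQQ]) hH.eigenvalues (by
      have h1 : Uᴴ * P * U + Uᴴ * Q * U - 1 = Uᴴ * (P + Q - 1) * U := by
        simp [mul_add, add_mul, mul_sub, sub_mul, hUU]
      rw [h1, hmul]
      simpa [Unitary.conjStarAlgAut_apply, star_eq_conjTranspose, ← hU, Function.comp_def]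
        using hspec)
  have := this.conj U
  rwa [hback, hback, mul_one, hUU'] at this

end BlockDecomposable

lemma QStrategy.exists_compression {n : ℕ}
    (S : QStrategy (fun _ : Fin n => Bool) (fun _ : Fin n => Bool)) (i : Fin n) :
    ∃ (K : Type) (_ : Fintype K) (θ : K → ℝ) (V : K → Matrix (Fin 2) (Fin (S.dim i)) ℂ),
      (∀ o d, S.proj i o d = ∑ k, (V k)ᴴ * qubitProj (if o then θ k else 0) d * V k) ∧
      ∑ k, (V k)ᴴ * V k = 1 := by
  obtain ⟨K, hK, θ, V, hP, hQ, hE⟩ := BlockDecomposable.of_projections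
    (S.proj_herm i false false).eq (S.proj_herm i true false).eq
    (S.proj_idem i false false) (S.proj_idem i true false)
  refine ⟨K, hK, θ, V, fun o d => ?_, hE.symm⟩
  have htrue (o : Bool) : S.proj i o true = 1 - S.proj i o false := by
    rw [← S.proj_sum i o, Fintype.sum_bool, add_sub_cancel_right]
  cases d
  · cases o
    · simpa using hP
    · simpa using hQ
  · rw [htrue]
    simp only [qubitProj_true, Matrix.mul_sub, Matrix.sub_mul, Matrix.mul_one,
      Finset.sum_sub_distrib, ← hE]
    cases o
    · simpa using hP
    · simpa using hQ

/-- The sesquilinear form `⟨ψ, (⊗ᵢ Mᵢ) ψ⟩`. -/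
noncomputable def tensorForm {n : ℕ} (dim : Fin n → ℕ)
    (M : ∀ i, Matrix (Fin (dim i)) (Fin (dim i)) ℂ) (ψ : (∀ i, Fin (dim i)) → ℂ) : ℂ :=
  ∑ x, ∑ y, (starRingEnd ℂ) (ψ x) * (∏ i, M i (x i) (y i)) * ψ y

lemma tensorForm_one {n : ℕ} (dim : Fin n → ℕ) (ψ : (∀ i, Fin (dim i)) → ℂ) :
    tensorForm dim (fun _ => 1) ψ = ((∑ x, Complex.normSq (ψ x) : ℝ) : ℂ) := by
  rw [Complex.ofReal_sum]
  refine Finset.sum_congr rfl fun x _ => ?_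
  rw [Finset.sum_eq_single x]
  · simp [Complex.normSq_eq_conj_mul_self]
  · intro y _ hy
    obtain ⟨i, hi⟩ := Function.ne_iff.1 hy
    have h0 : ∏ i, (1 : Matrix (Fin (dim i)) (Fin (dim i)) ℂ) (x i) (y i) = 0 :=
      Finset.prod_eq_zero (Finset.mem_univ i) (Matrix.one_apply_ne hi.symm)
    simp [h0]
  · simp

lemma tensorForm_smul {n : ℕ} (dim : Fin n → ℕ) (M : ∀ i, Matrix (Fin (dim i)) (Fin (dim i)) ℂ)
    (t : ℝ) (ψ : (∀ i, Fin (dim i)) → ℂ) :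
    tensorForm dim M (fun x => t * ψ x) = ((t ^ 2 : ℝ) : ℂ) * tensorForm dim M ψ := by
  simp only [tensorForm, Finset.mul_sum]
  refine Finset.sum_congr rfl fun x _ => Finset.sum_congr rfl fun y _ => ?_
  simp
  ring

/-- The image of `ψ` under `⊗ᵢ Vᵢ`. -/
noncomputable def tensorApply {n : ℕ} {dim dim' : Fin n → ℕ}
    (V : ∀ i, Matrix (Fin (dim' i)) (Fin (dim i)) ℂ) (ψ : (∀ i, Fin (dim i)) → ℂ) :
    (∀ i, Fin (dim' i)) → ℂ :=
  fun z => ∑ x, (∏ i, V i (z i) (x i)) * ψ x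

lemma tensorForm_sum {n : ℕ} {dim : Fin n → ℕ} {K : Fin n → Type} [∀ i, Fintype (K i)]
    (M : ∀ i, K i → Matrix (Fin (dim i)) (Fin (dim i)) ℂ) (ψ : (∀ i, Fin (dim i)) → ℂ) :
    tensorForm dim (fun i => ∑ k, M i k) ψ =
      ∑ κ : ∀ i, K i, tensorForm dim (fun i => M i (κ i)) ψ := by
  simp only [tensorForm, Matrix.sum_apply, Fintype.prod_sum, Finset.mul_sum, Finset.sum_mul]
  rw [Finset.sum_comm (s := (Finset.univ : Finset (∀ i, K i)))]
  refine Finset.sum_congr rfl fun x _ => ?_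
  rw [Finset.sum_comm]

lemma sum_sum_sum_sum_reverse {α β γ δ R : Type*} [Fintype α] [Fintype β] [Fintype γ] [Fintype δ]
    [AddCommMonoid R] (f : α → β → γ → δ → R) :
    ∑ a, ∑ b, ∑ c, ∑ d, f a b c d = ∑ d, ∑ c, ∑ b, ∑ a, f a b c d := by
  calc _ = ∑ a, ∑ d, ∑ c, ∑ b, f a b c d := by
        refine Finset.sum_congr rfl fun a _ => ?_
        rw [Finset.sum_comm_cycle]
        exact Finset.sum_congr rfl fun d _ => Finset.sum_comm
    _ = _ := by
        rw [Finset.sum_comm]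
        refine Finset.sum_congr rfl fun d _ => ?_
        rw [Finset.sum_comm]
        exact Finset.sum_congr rfl fun c _ => Finset.sum_comm

lemma tensorForm_compression {n : ℕ} {dim dim' : Fin n → ℕ}
    (V : ∀ i, Matrix (Fin (dim' i)) (Fin (dim i)) ℂ)
    (M : ∀ i, Matrix (Fin (dim' i)) (Fin (dim' i)) ℂ) (ψ : (∀ i, Fin (dim i)) → ℂ) :
    tensorForm dim (fun i => (V i)ᴴ * M i * V i) ψ = tensorForm dim' M (tensorApply V ψ) := by
  have hentry (x y : ∀ i, Fin (dim i)) :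
      ∏ i, ((V i)ᴴ * M i * V i) (x i) (y i) =
        ∑ z' : ∀ i, Fin (dim' i), ∑ z : ∀ i, Fin (dim' i),
          (∏ i, (starRingEnd ℂ) (V i (z i) (x i))) * (∏ i, M i (z i) (z' i)) *
            ∏ i, V i (z' i) (y i) := by
    simp only [Matrix.mul_apply, Fintype.prod_sum, Finset.prod_mul_distrib, Finset.sum_mul]
    rfl
  simp only [tensorForm, tensorApply, hentry, map_sum, map_mul, map_prod, Finset.sum_mul,
    Finset.mul_sum]
  rw [sum_sum_sum_sum_reverse]
  refine Finset.sum_congr rfl fun z _ => Finset.sum_congr rfl fun z' _ =>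
    Finset.sum_congr rfl fun y _ => Finset.sum_congr rfl fun x _ => ?_
  ring

lemma tensorForm_sum_compression {n : ℕ} {dim dim' : Fin n → ℕ} {K : Fin n → Type}
    [∀ i, Fintype (K i)] (V : ∀ i, K i → Matrix (Fin (dim' i)) (Fin (dim i)) ℂ)
    (M : ∀ i, K i → Matrix (Fin (dim' i)) (Fin (dim' i)) ℂ) (ψ : (∀ i, Fin (dim i)) → ℂ) :
    tensorForm dim (fun i => ∑ k, (V i k)ᴴ * M i k * V i k) ψ =
      ∑ κ : ∀ i, K i, tensorForm dim' (fun i => M i (κ i)) (tensorApply (fun i => V i (κ i)) ψ) := by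
  rw [tensorForm_sum]
  exact Finset.sum_congr rfl fun κ _ => tensorForm_compression _ _ _

/-- The operator effectively measured by a party of efficiency `η`: the projector `P` on success,
and on loss the identity or zero according to whether the fallback outputs the decision. -/
noncomputable def lossyOp {m : ℕ} (η : ℝ) (b : Prop) [Decidable b]
    (P : Matrix (Fin m) (Fin m) ℂ) : Matrix (Fin m) (Fin m) ℂ :=
  ((1 - η : ℝ) : ℂ) • (if b then 1 else 0) + (η : ℂ) • P

lemma lossyProjBehavior_eq {n : ℕ} {O D : Fin n → Type} [∀ i, DecidableEq (D i)]
    (dim : Fin n → ℕ) (proj : ∀ i, O i → D i → Matrix (Fin (dim i)) (Fin (dim i)) ℂ)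
    (ψ : (∀ i, Fin (dim i)) → ℂ) (f : ∀ i, O i → D i) (η : Fin n → ℝ)
    (o : ∀ i, O i) (d : ∀ i, D i) :
    lossyProjBehavior dim proj ψ f η o d =
      (tensorForm dim (fun i => lossyOp (η i) (d i = f i (o i)) (proj i (o i) (d i))) ψ).re := by
  have h (x y : ∀ i, Fin (dim i)) :
      ∏ i, lossyOp (η i) (d i = f i (o i)) (proj i (o i) (d i)) (x i) (y i) =
        ∑ T : Finset (Fin n), (((∏ i ∈ T, (1 - η i)) * ∏ i ∈ Tᶜ, η i : ℝ) : ℂ) *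
          ∏ i, (if i ∈ T then
            (if d i = f i (o i) then (1 : Matrix (Fin (dim i)) (Fin (dim i)) ℂ) else 0)
            else proj i (o i) (d i)) (x i) (y i) := by
    simp only [lossyOp, Matrix.add_apply, Matrix.smul_apply, smul_eq_mul]
    rw [Fintype.prod_add]
    refine Finset.sum_congr rfl fun T _ => ?_
    have h_mem : ∏ i ∈ T, (if i ∈ T then
        (if d i = f i (o i) then (1 : Matrix (Fin (dim i)) (Fin (dim i)) ℂ) else 0)
        else proj i (o i) (d i)) (x i) (y i) = ∏ i ∈ T, (if d i = f i (o i) then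
          (1 : Matrix (Fin (dim i)) (Fin (dim i)) ℂ) else 0) (x i) (y i) :=
      Finset.prod_congr rfl fun i hi => by rw [if_pos hi]
    have h_compl : ∏ i ∈ Tᶜ, (if i ∈ T then
        (if d i = f i (o i) then (1 : Matrix (Fin (dim i)) (Fin (dim i)) ℂ) else 0)
        else proj i (o i) (d i)) (x i) (y i) = ∏ i ∈ Tᶜ, proj i (o i) (d i) (x i) (y i) :=
      Finset.prod_congr rfl fun i hi => by rw [if_neg (Finset.mem_compl.1 hi)]
    rw [Finset.prod_mul_distrib, Finset.prod_mul_distrib, ← Finset.prod_mul_prod_compl T,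
      h_mem, h_compl]
    push_cast
    ring
  simp only [tensorForm, h]
  simp only [lossyProjBehavior, projBehavior, ← Complex.re_ofReal_mul, ← Complex.re_sum]
  congr 1
  simp only [Finset.mul_sum, Finset.sum_mul]
  rw [Finset.sum_comm]
  refine Finset.sum_congr rfl fun x _ => ?_
  rw [Finset.sum_comm]
  refine Finset.sum_congr rfl fun y _ => Finset.sum_congr rfl fun T _ => ?_
  ring

lemma projBehavior_eq_lossyProjBehavior {n : ℕ} {O D : Fin n → Type} [∀ i, DecidableEq (D i)]
    (dim : Fin n → ℕ) (proj : ∀ i, O i → D i → Matrix (Fin (dim i)) (Fin (dim i)) ℂ)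
    (ψ : (∀ i, Fin (dim i)) → ℂ) (f : ∀ i, O i → D i) :
    projBehavior dim proj ψ = lossyProjBehavior dim proj ψ f (fun _ => 1) := by
  ext o d
  simp [lossyProjBehavior_eq, lossyOp, projBehavior, tensorForm]

lemma lossyOp_sum_compression {m m' : ℕ} {K : Type} [Fintype K] (η : ℝ) (b : Prop) [Decidable b]
    (V : K → Matrix (Fin m') (Fin m) ℂ) (hV : ∑ k, (V k)ᴴ * V k = 1)
    (P : K → Matrix (Fin m') (Fin m') ℂ) :
    lossyOp η b (∑ k, (V k)ᴴ * P k * V k) = ∑ k, (V k)ᴴ * lossyOp η b (P k) * V k := by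
  simp only [lossyOp, Matrix.mul_add, Matrix.add_mul, Finset.sum_add_distrib, Matrix.mul_smul,
    Matrix.smul_mul, ← Finset.smul_sum]
  split_ifs <;> simp [hV]

lemma expUtility_lossyProjBehavior_smul {n : ℕ} {O D : Fin n → Type} [∀ i, Fintype (O i)]
    [∀ i, Fintype (D i)] [∀ i, DecidableEq (D i)] (w : (∀ i, O i) → (∀ i, D i) → ℝ)
    (dim : Fin n → ℕ) (proj : ∀ i, O i → D i → Matrix (Fin (dim i)) (Fin (dim i)) ℂ)
    (ψ : (∀ i, Fin (dim i)) → ℂ) (f : ∀ i, O i → D i) (η : Fin n → ℝ) (t : ℝ) :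
    expUtility w (lossyProjBehavior dim proj (fun x => t * ψ x) f η) =
      t ^ 2 * expUtility w (lossyProjBehavior dim proj ψ f η) := by
  simp only [expUtility, Finset.mul_sum]
  refine Finset.sum_congr rfl fun o _ => Finset.sum_congr rfl fun d _ => ?_
  rw [lossyProjBehavior_eq, lossyProjBehavior_eq, tensorForm_smul, Complex.re_ofReal_mul, mul_assoc]

lemma exists_qubit_expUtility_ge {n : ℕ} (w : (Fin n → Bool) → (Fin n → Bool) → ℝ)
    (η : Fin n → ℝ) (S : QStrategy (fun _ : Fin n => Bool) (fun _ : Fin n => Bool))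
    (f : ∀ _ : Fin n, Bool → Bool) :
    ∃ (θ : Fin n → ℝ) (ψ : (Fin n → Fin 2) → ℂ), (∑ v, Complex.normSq (ψ v)) = 1 ∧
      expUtility w (lossyBehavior S f η) ≤ expUtility w
        (lossyProjBehavior (O := fun _ : Fin n => Bool) (D := fun _ : Fin n => Bool)
          (fun _ => 2) (fun i oi di => qubitProj (if oi then θ i else 0) di) ψ f η) := by
  choose K hK θ V hproj hV using S.exists_compression
  let φ (κ : ∀ i, K i) : (Fin n → Fin 2) → ℂ :=
    tensorApply (dim' := fun _ => 2) (fun i => V i (κ i)) S.state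
  let N (κ : ∀ i, K i) : ℝ := ∑ v, Complex.normSq (φ κ v)
  let value (κ : ∀ i, K i) (ψ : (Fin n → Fin 2) → ℂ) : ℝ := expUtility w
    (lossyProjBehavior (O := fun _ : Fin n => Bool) (D := fun _ : Fin n => Bool)
      (fun _ => 2) (fun i oi di => qubitProj (if oi then θ i (κ i) else 0) di) ψ f η)
  have hN : ∑ κ, N κ = 1 := by
    have h := tensorForm_sum_compression (dim' := fun _ => 2) V (fun _ _ => 1) S.state
    simp only [Matrix.mul_one, hV, tensorForm_one, S.state_norm] at h
    exact_mod_cast h.symm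
  have hvalue : expUtility w (lossyBehavior S f η) = ∑ κ, value κ (φ κ) := by
    simp only [value, expUtility]
    conv_rhs => rw [Finset.sum_comm]
    refine Finset.sum_congr rfl fun o _ => ?_
    conv_rhs => rw [Finset.sum_comm]
    refine Finset.sum_congr rfl fun d _ => ?_
    rw [← Finset.sum_mul]
    congr 1
    simp only [lossyBehavior, lossyProjBehavior_eq, ← Complex.re_sum, hproj]
    simp only [fun i (b : Prop) [Decidable b] P => lossyOp_sum_compression (η i) b (V i) (hV i) P]
    congr 1
    exact tensorForm_sum_compression (dim' := fun _ => 2) V _ S.state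
  obtain ⟨κ, hκ0, hκ⟩ : ∃ κ, 0 < N κ ∧
      expUtility w (lossyBehavior S f η) * N κ ≤ value κ (φ κ) := by
    by_contra! hcon
    have hnonneg (κ) : 0 ≤ N κ := Finset.sum_nonneg fun v _ => Complex.normSq_nonneg _
    have hle (κ) : value κ (φ κ) ≤ expUtility w (lossyBehavior S f η) * N κ := by
      rcases (hnonneg κ).eq_or_lt with h0 | h0
      · have hφ : φ κ = fun v => ((0 : ℝ) : ℂ) * φ κ v := by
          ext v
          have := (Finset.sum_eq_zero_iff_of_nonneg
            fun v _ => Complex.normSq_nonneg (φ κ v)).1 h0.symm v (Finset.mem_univ v)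
          simpa using this
        rw [← h0, hφ]
        simp only [value]
        rw [expUtility_lossyProjBehavior_smul]
        simp
      · exact (hcon κ h0).le
    obtain ⟨κ, hκ⟩ : ∃ κ, 0 < N κ := by
      by_contra! h
      linarith [Finset.sum_nonpos fun κ (_ : κ ∈ Finset.univ) => h κ]
    have := Finset.sum_lt_sum (fun κ _ => hle κ) ⟨κ, Finset.mem_univ κ, hcon κ hκ⟩
    rw [← Finset.mul_sum, hN, mul_one, ← hvalue] at this
    exact this.false
  have ht : (√(N κ))⁻¹ ^ 2 = (N κ)⁻¹ := by rw [inv_pow, Real.sq_sqrt hκ0.le]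
  refine ⟨fun i => θ i (κ i), fun v => (((√(N κ))⁻¹ : ℝ) : ℂ) * φ κ v, ?_, ?_⟩
  · simp only [Complex.normSq_mul, Complex.normSq_ofReal, ← Finset.mul_sum]
    rw [← sq, ht]
    exact inv_mul_cancel₀ hκ0.ne'
  · rw [expUtility_lossyProjBehavior_smul, ht, le_inv_mul_iff₀ hκ0, mul_comm]
    exact hκ

/-- The qubit strategy measuring in the computational basis on the first observation and in the
real basis of angle `θ i` on the second. -/
noncomputable def qubitStrategy {n : ℕ} (θ : Fin n → ℝ) (ψ : (Fin n → Fin 2) → ℂ)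
    (hψ : (∑ v, Complex.normSq (ψ v)) = 1) :
    QStrategy (fun _ : Fin n => Bool) (fun _ : Fin n => Bool) where
  dim := fun _ => 2
  dim_pos := fun _ => two_pos
  proj := fun i oi di => qubitProj (if oi then θ i else 0) di
  proj_herm := fun _ _ _ => qubitProj_isHermitian _ _
  proj_idem := fun _ _ _ => qubitProj_mul_self _ _
  proj_orth := fun _ _ _ _ h => qubitProj_mul_of_ne _ h
  proj_sum := fun _ _ => sum_qubitProj _
  state := ψ
  state_norm := hψ

end TC

open TC in
/-- for an (n,2,2) problem, the quantum value equals the supremum over qubit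
strategies in which each party measures in the computational basis upon the first observation
(`false`) and in a real basis `{(cos θᵢ, −sin θᵢ), (sin θᵢ, cos θᵢ)}` upon the second
observation (`true`); so `n` real parameters `θ₁, …, θₙ` suffice, the measurement phases
being removable. The same holds for the `{ηᵢ}`-lossy value. -/
theorem qValue_real_qubit_parameterization {n : ℕ}
    (w : (Fin n → Bool) → (Fin n → Bool) → ℝ) (η : Fin n → ℝ)
    (hη : ∀ i, η i ∈ Set.Icc (0 : ℝ) 1) :
    qValue (O := fun _ : Fin n => Bool) (D := fun _ : Fin n => Bool) w =
      sSup {x : ℝ | ∃ (θ : Fin n → ℝ) (ψ : (Fin n → Fin 2) → ℂ),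
        (∑ v, Complex.normSq (ψ v)) = 1 ∧
        x = expUtility w
          (projBehavior (O := fun _ : Fin n => Bool) (D := fun _ : Fin n => Bool)
            (fun _ => 2) (fun i oi di => qubitProj (if oi then θ i else 0) di) ψ)} ∧
    sSup {x : ℝ | ∃ (S : QStrategy (fun _ : Fin n => Bool) (fun _ : Fin n => Bool))
        (f : ∀ _ : Fin n, Bool → Bool),
        x = expUtility w (lossyBehavior S f η)} =
      sSup {x : ℝ | ∃ (θ : Fin n → ℝ) (ψ : (Fin n → Fin 2) → ℂ)
        (f : ∀ _ : Fin n, Bool → Bool),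
        (∑ v, Complex.normSq (ψ v)) = 1 ∧
        x = expUtility w
          (lossyProjBehavior (O := fun _ : Fin n => Bool) (D := fun _ : Fin n => Bool)
            (fun _ => 2) (fun i oi di => qubitProj (if oi then θ i else 0) di) ψ f η)} := by
  refine ⟨?_, ?_⟩
  · refine csSup_eq_csSup_of_forall_exists_le ?_ ?_
    · rintro _ ⟨S, rfl⟩
      obtain ⟨θ, ψ, hψ, h⟩ := exists_qubit_expUtility_ge w (fun _ => 1) S fun _ => id
      refine ⟨_, ⟨θ, ψ, hψ, rfl⟩, ?_⟩
      rwa [QStrategy.behavior, projBehavior_eq_lossyProjBehavior (f := fun _ => id),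
        projBehavior_eq_lossyProjBehavior (f := fun _ => id)]
    · rintro _ ⟨θ, ψ, hψ, rfl⟩
      exact ⟨_, ⟨qubitStrategy θ ψ hψ, rfl⟩, le_rfl⟩
  · refine csSup_eq_csSup_of_forall_exists_le ?_ ?_
    · rintro _ ⟨S, f, rfl⟩
      obtain ⟨θ, ψ, hψ, h⟩ := exists_qubit_expUtility_ge w η S f
      exact ⟨_, ⟨θ, ψ, f, hψ, rfl⟩, h⟩
    · rintro _ ⟨θ, ψ, f, hψ, rfl⟩
      exact ⟨_, ⟨qubitStrategy θ ψ hψ, f, rfl⟩, le_rfl⟩
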